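/- There exists a continuous function f on [0,1)² belonging to {n·α_n/log(n+1)}#BV (for any prescribed α_n → ∞) whose quadratic partial sums S_{N,N}(0,0;f) of the double Walsh–Fourier series are unbounded: sup_N |S_{N,N}(0,0;f)| = +∞. -/

import Mathlib

open MeasureTheory Filter Set ENNReal

noncomputable section

/-- The basic Rademacher-type function: 1 on [0,1/2), -1 on [1/2,1), 1-periodic. -/
def r0 (x : ℝ) : ℝ := if Int.fract x < 1/2 then 1 else -1

/-- The Walsh functions: products of Rademacher functions according to binary digits. -/
def walsh (k : ℕ) (x : ℝ) : ℝ :=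
  ∏ j ∈ Finset.range k, if k.testBit j then r0 (2 ^ j * x) else 1

/-- The Walsh–Dirichlet kernel `D_n`. -/
def walshDirichlet (n : ℕ) (x : ℝ) : ℝ :=
  ∑ k ∈ Finset.range n, walsh k x

/-- A finite ordered family of nonoverlapping subintervals of `[0,1)`. -/
structure IntervalPack (n : ℕ) where
  a : Fin n → ℝ
  b : Fin n → ℝ
  ha : ∀ i, 0 ≤ a i
  hab : ∀ i, a i < b i
  hb : ∀ i, b i ≤ 1
  disj : ∀ i j, i ≠ j → Disjoint (Ioo (a i) (b i)) (Ioo (a j) (b j))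

/-- A family of nonoverlapping intervals together with a point `y i` for each interval. -/
structure SharpPack (n : ℕ) extends IntervalPack n where
  y : Fin n → ℝ
  hy : ∀ i, y i ∈ Ico (0:ℝ) 1

/-- The `Λ^#`-variation sum of `f` over a pack, with weight sequence shifted by `m`
(weight `Λ (m+i)` for the `i`-th interval, `1`-based). -/
def sharpSum {n : ℕ} (Λ : ℕ → ℝ) (m : ℕ) (f : ℝ → ℝ → ℝ) (P : SharpPack n) : ℝ≥0∞ :=
  ∑ i : Fin n, ENNReal.ofReal
    (|f (P.b i) (P.y i) - f (P.a i) (P.y i)| / Λ (m + i.1 + 1))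

/-- `Λ_m^# V_1 (f)`. -/
def sharpV1 (Λ : ℕ → ℝ) (m : ℕ) (f : ℝ → ℝ → ℝ) : ℝ≥0∞ :=
  ⨆ (n : ℕ) (P : SharpPack n), sharpSum Λ m f P

/-- `Λ_m^# V_2 (f)`. -/
def sharpV2 (Λ : ℕ → ℝ) (m : ℕ) (f : ℝ → ℝ → ℝ) : ℝ≥0∞ :=
  sharpV1 Λ m (fun x y => f y x)

/-- `Λ_m^# V (f) = Λ_m^# V_1 (f) + Λ_m^# V_2 (f)`. -/
def sharpV (Λ : ℕ → ℝ) (m : ℕ) (f : ℝ → ℝ → ℝ) : ℝ≥0∞ :=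
  sharpV1 Λ m f + sharpV2 Λ m f

/-- `f ∈ Λ^# BV`: bounded `Λ^#`-variation. -/
def SharpBV (Λ : ℕ → ℝ) (f : ℝ → ℝ → ℝ) : Prop := sharpV Λ 0 f ≠ ⊤

/-- `f ∈ C Λ^# V`: continuity in `Λ^#`-variation, i.e. `Λ_m^# V (f) → 0`. -/
def CSharpV (Λ : ℕ → ℝ) (f : ℝ → ℝ → ℝ) : Prop :=
  Tendsto (fun m => sharpV Λ m f) atTop (nhds 0)

/-- `v_1^#(n, f)`: supremum of sums of `n` increments over `n` nonoverlapping
intervals, with freely chosen points `y_i`. -/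
def vSharp1 (f : ℝ → ℝ → ℝ) (n : ℕ) : ℝ≥0∞ :=
  ⨆ (P : SharpPack n), ∑ i : Fin n,
    ENNReal.ofReal |f (P.b i) (P.y i) - f (P.a i) (P.y i)|

def vSharp2 (f : ℝ → ℝ → ℝ) (n : ℕ) : ℝ≥0∞ := vSharp1 (fun x y => f y x) n

/-- `Λ V_1 (f)`: one fixed `y` for the whole family of intervals. -/
def lineV1 (Λ : ℕ → ℝ) (f : ℝ → ℝ → ℝ) : ℝ≥0∞ :=
  ⨆ (n : ℕ) (y : Ico (0:ℝ) 1) (P : IntervalPack n),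
    ∑ i : Fin n, ENNReal.ofReal (|f (P.b i) (y : ℝ) - f (P.a i) (y : ℝ)| / Λ (i.1 + 1))

def lineV2 (Λ : ℕ → ℝ) (f : ℝ → ℝ → ℝ) : ℝ≥0∞ := lineV1 Λ (fun x y => f y x)

/-- The mixed `(Λ¹,Λ²)`-variation `(Λ¹Λ²) V_{1,2}(f)`. -/
def mixedV (Λ₁ Λ₂ : ℕ → ℝ) (f : ℝ → ℝ → ℝ) : ℝ≥0∞ :=
  ⨆ (n : ℕ) (m : ℕ) (P : IntervalPack n) (Q : IntervalPack m),
    ∑ i : Fin n, ∑ j : Fin m, ENNReal.ofReal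
      (|f (P.a i) (Q.a j) - f (P.a i) (Q.b j) - f (P.b i) (Q.a j) + f (P.b i) (Q.b j)| /
        (Λ₁ (i.1 + 1) * Λ₂ (j.1 + 1)))

/-- Harmonic bounded variation `HBV` in the sense of Hardy–Krause/Waterman type. -/
def HBV (f : ℝ → ℝ → ℝ) : Prop :=
  lineV1 (fun n => (n : ℝ)) f + lineV2 (fun n => (n : ℝ)) f +
    mixedV (fun n => (n : ℝ)) (fun n => (n : ℝ)) f ≠ ⊤

/-- A finite family of nonoverlapping rectangles in `[0,1)²`. -/
structure RectPack (n : ℕ) where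
  a : Fin n → ℝ
  b : Fin n → ℝ
  c : Fin n → ℝ
  d : Fin n → ℝ
  ha : ∀ i, 0 ≤ a i
  hab : ∀ i, a i < b i
  hb : ∀ i, b i ≤ 1
  hc : ∀ i, 0 ≤ c i
  hcd : ∀ i, c i < d i
  hd : ∀ i, d i ≤ 1
  disj : ∀ i j, i ≠ j →
    Disjoint (Ioo (a i) (b i) ×ˢ Ioo (c i) (d i)) (Ioo (a j) (b j) ×ˢ Ioo (c j) (d j))

/-- The Dyachenko–Waterman rectangular variation `Λ* V (f)`. -/
def rectV (Λ : ℕ → ℝ) (f : ℝ → ℝ → ℝ) : ℝ≥0∞ :=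
  ⨆ (n : ℕ) (R : RectPack n), ∑ i : Fin n, ENNReal.ofReal
    (|f (R.a i) (R.c i) - f (R.a i) (R.d i) - f (R.b i) (R.c i) + f (R.b i) (R.d i)| /
      Λ (i.1 + 1))

/-- `q_N = 4^0 + 4^1 + ⋯ + 4^{N-1}`. -/
def qIdx (N : ℕ) : ℕ := ∑ k ∈ Finset.range N, 4 ^ k

/-- The tent function `φ_{N,j}` of height 1 on `[j 2^{-2N}, (j+1) 2^{-2N}]`. -/
def tent (N j : ℕ) (x : ℝ) : ℝ :=
  max 0 (1 - |2 ^ (2 * N + 1) * x - (2 * j + 1)|)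

/-- `φ_N = ∑_{j=1}^{2^{2N}-1} φ_{N,j}`. -/
def tentSum (N : ℕ) (x : ℝ) : ℝ :=
  ∑ j ∈ Finset.Icc 1 (2 ^ (2 * N) - 1), tent N j x

/-- `A_n^α = (α+1)(α+2)⋯(α+n)/n!`. -/
def Acoef (α : ℝ) (n : ℕ) : ℝ :=
  (∏ k ∈ Finset.range n, (α + k + 1)) / n.factorial

/-- The Cesàro `(C,α)` kernel for the Walsh system. -/
def cesaroKernel (α : ℝ) (n : ℕ) (x : ℝ) : ℝ :=
  (Acoef α (n - 1))⁻¹ * ∑ k ∈ Finset.Icc 1 n, Acoef (α - 1) (n - k) * walshDirichlet k x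

/-- The `(n,m)`-th Walsh–Fourier coefficient of `f`. -/
def fourierCoef (f : ℝ → ℝ → ℝ) (n m : ℕ) : ℝ :=
  ∫ x in (0:ℝ)..1, ∫ y in (0:ℝ)..1, f x y * walsh n x * walsh m y

/-- The rectangular partial sums of the double Walsh–Fourier series of `f`. -/
def partialSum (f : ℝ → ℝ → ℝ) (M N : ℕ) (x y : ℝ) : ℝ :=
  ∑ m ∈ Finset.range M, ∑ n ∈ Finset.range N, fourierCoef f m n * walsh m x * walsh n y

/-- The Cesàro `(C;α,β)` means of the double Walsh–Fourier series of `f`. -/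
def cesaroMean (α β : ℝ) (n m : ℕ) (f : ℝ → ℝ → ℝ) (x y : ℝ) : ℝ :=
  (Acoef α (n - 1) * Acoef β (m - 1))⁻¹ *
    ∑ i ∈ Finset.Icc 1 n, ∑ j ∈ Finset.Icc 1 m,
      Acoef (α - 1) (n - i) * Acoef (β - 1) (m - j) * partialSum f i j x y

/-- The sup norm of `f` over `[0,1]²` (in `ℝ≥0∞`). -/
def supNorm (f : ℝ → ℝ → ℝ) : ℝ≥0∞ :=
  ⨆ (x : Icc (0:ℝ) 1) (y : Icc (0:ℝ) 1), ENNReal.ofReal |f x y|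

/-- The norm `‖f‖_C + Λ^# V (f)` on `C ∩ Λ^# BV` (in `ℝ≥0∞`). -/
def bvNorm (Λ : ℕ → ℝ) (f : ℝ → ℝ → ℝ) : ℝ≥0∞ :=
  supNorm f + sharpV Λ 0 f

end

/-! ### Walsh functions and Dirichlet kernels -/

lemma r0_periodic : Function.Periodic r0 1 := fun x => by simp [r0]

lemma measurable_r0 : Measurable r0 :=
  Measurable.ite (measurableSet_lt measurable_fract measurable_const)
    measurable_const measurable_const

lemma abs_r0 (x : ℝ) : |r0 x| = 1 := by
  unfold r0; split_ifs <;> simp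

lemma r0_mul_self (x : ℝ) : r0 x * r0 x = 1 := by
  unfold r0; split_ifs <;> simp

lemma walsh_eq_prod {k M : ℕ} (h : k ≤ M) (x : ℝ) :
    walsh k x = ∏ j ∈ Finset.range M, if k.testBit j then r0 (2 ^ j * x) else 1 := by
  refine Finset.prod_subset (Finset.range_subset_range.2 h) fun j _ hj => ?_
  have hk : k < 2 ^ j :=
    lt_of_le_of_lt (by simpa using hj) j.lt_two_pow_self
  simp [Nat.testBit_lt_two_pow hk]

lemma walsh_two_mul (k : ℕ) (x : ℝ) : walsh (2 * k) x = walsh k (2 * x) := by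
  rw [walsh_eq_prod (Nat.le_succ (2 * k)), Finset.prod_range_succ',
    walsh_eq_prod (show k ≤ 2 * k by omega)]
  simp [Nat.testBit_succ, pow_succ, mul_assoc]

lemma walsh_two_mul_add_one (k : ℕ) (x : ℝ) :
    walsh (2 * k + 1) x = r0 x * walsh k (2 * x) := by
  rw [walsh_eq_prod le_rfl, Finset.prod_range_succ', walsh_eq_prod (show k ≤ 2 * k by omega)]
  have h : ∀ j, (2 * k + 1).testBit (j + 1) = k.testBit j := fun j => by
    rw [Nat.testBit_succ]; congr 1; omega
  simp only [h, Nat.testBit_zero, pow_succ, mul_assoc, mul_comm (r0 x)]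
  simp

lemma walsh_zero_right (k : ℕ) : walsh k 0 = 1 := by
  unfold walsh
  refine Finset.prod_eq_one fun j _ => ?_
  simp [r0]

lemma abs_walsh (k : ℕ) (x : ℝ) : |walsh k x| = 1 := by
  unfold walsh
  rw [Finset.abs_prod]
  refine Finset.prod_eq_one fun j _ => ?_
  split_ifs <;> simp [abs_r0]

lemma measurable_walsh (k : ℕ) : Measurable (walsh k) := by
  refine Finset.measurable_fun_prod _ fun j _ => ?_
  split_ifs
  · exact measurable_r0.comp (measurable_const_mul _)
  · exact measurable_const

lemma walsh_periodic (k : ℕ) : Function.Periodic (walsh k) 1 := fun x => by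
  unfold walsh
  refine Finset.prod_congr rfl fun j _ => ?_
  have h : r0 (2 ^ j * (x + 1)) = r0 (2 ^ j * x) := by
    have := r0_periodic.nat_mul (2 ^ j) (2 ^ j * x)
    simpa [mul_add] using this
  rw [h]

lemma walshDirichlet_two_mul (n : ℕ) (x : ℝ) :
    walshDirichlet (2 * n) x = (1 + r0 x) * walshDirichlet n (2 * x) := by
  unfold walshDirichlet
  induction n with
  | zero => simp
  | succ n ih =>
    rw [show 2 * (n + 1) = 2 * n + 1 + 1 by ring, Finset.sum_range_succ, Finset.sum_range_succ, ih,
      Finset.sum_range_succ _ n, walsh_two_mul, walsh_two_mul_add_one]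
    ring

lemma qIdx_succ (N : ℕ) : qIdx (N + 1) = 2 * (2 * qIdx N) + 1 := by
  unfold qIdx
  rw [Finset.sum_range_succ', ← mul_assoc, Finset.mul_sum]
  simp [pow_succ, mul_comm]

lemma walsh_qIdx_succ (N : ℕ) (x : ℝ) :
    walsh (qIdx (N + 1)) x = r0 x * walsh (qIdx N) (4 * x) := by
  rw [qIdx_succ, walsh_two_mul_add_one, walsh_two_mul, ← mul_assoc]; norm_num

lemma walshDirichlet_qIdx_succ (N : ℕ) (x : ℝ) :
    walshDirichlet (qIdx (N + 1)) x =
      (1 + r0 x) * (1 + r0 (2 * x)) * walshDirichlet (qIdx N) (4 * x)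
        + walsh (qIdx N) (4 * x) := by
  have h : walshDirichlet (2 * (2 * qIdx N) + 1) x =
      walshDirichlet (2 * (2 * qIdx N)) x + walsh (2 * (2 * qIdx N)) x :=
    Finset.sum_range_succ _ _
  rw [qIdx_succ, h, walshDirichlet_two_mul, walshDirichlet_two_mul, walsh_two_mul, walsh_two_mul,
    ← mul_assoc 2 2 x]
  norm_num [mul_assoc]

lemma measurable_walshDirichlet (n : ℕ) : Measurable (walshDirichlet n) :=
  Finset.measurable_fun_sum _ fun k _ => measurable_walsh k

lemma walshDirichlet_periodic (n : ℕ) : Function.Periodic (walshDirichlet n) 1 := fun x =>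
  Finset.sum_congr rfl fun k _ => walsh_periodic k x

lemma abs_walshDirichlet_le (n : ℕ) (x : ℝ) : |walshDirichlet n x| ≤ n := by
  refine (Finset.abs_sum_le_sum_abs _ _).trans ?_
  simp [abs_walsh]

/-! ### Integrals over quarters of the unit interval -/

lemma intervalIntegrable_of_abs_le {f : ℝ → ℝ} (hf : Measurable f) {C : ℝ}
    (hC : ∀ x, |f x| ≤ C) (a b : ℝ) : IntervalIntegrable f volume a b :=
  intervalIntegrable_iff.2 <| Measure.integrableOn_of_bounded (M := C) (by simp)
    hf.aestronglyMeasurable (Eventually.of_forall hC)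

lemma integral_quarter {H F : ℝ → ℝ} (hF : Function.Periodic F 1) (j : ℕ)
    (h : ∀ x ∈ Ioo ((j : ℝ) / 4) (((j + 1 : ℕ) : ℝ) / 4), H x = F (4 * x)) :
    ∫ x in (j : ℝ) / 4..((j + 1 : ℕ) : ℝ) / 4, H x = (∫ x in (0 : ℝ)..1, F x) / 4 := by
  rw [intervalIntegral.integral_congr_Ioo_of_le (g := fun x => F (4 * x)) (by gcongr; omega) h,
    intervalIntegral.integral_comp_mul_left _ four_ne_zero]
  have := hF.intervalIntegral_add_eq (j : ℝ) 0
  rw [zero_add] at this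
  rw [show (4 : ℝ) * (j / 4) = j by ring, show (4 : ℝ) * (((j + 1 : ℕ) : ℝ) / 4) = j + 1 by
    push_cast; ring, this, smul_eq_mul]
  ring

lemma integral_eq_sum_quarters {H : ℝ → ℝ} (hH : ∀ a b, IntervalIntegrable H volume a b)
    {F : ℕ → ℝ → ℝ} (hF : ∀ j, Function.Periodic (F j) 1)
    (h : ∀ j : ℕ, j < 4 → ∀ x ∈ Ioo ((j : ℝ) / 4) (((j + 1 : ℕ) : ℝ) / 4), H x = F j (4 * x)) :
    ∫ x in (0 : ℝ)..1, H x = ∑ j ∈ Finset.range 4, (∫ x in (0 : ℝ)..1, F j x) / 4 := by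
  have := intervalIntegral.sum_integral_adjacent_intervals (f := H) (μ := volume)
    (a := fun j : ℕ => (j : ℝ) / 4) (n := 4) fun k _ => hH _ _
  norm_num at this
  rw [← this]
  refine Finset.sum_congr rfl fun j hj => ?_
  rw [← integral_quarter (hF j) j (h j (Finset.mem_range.1 hj))]
  simp

/-! ### Oscillating test functions -/

lemma fract_lt_iff (x : ℝ) (c : ℤ) : Int.fract x < c / 4 ↔ ⌊4 * x⌋ % 4 < c := by
  have h1 : 4 * ⌊x⌋ ≤ ⌊4 * x⌋ := by
    rw [Int.le_floor]; push_cast; linarith [Int.floor_le x]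
  have h2 : ⌊4 * x⌋ < 4 * ⌊x⌋ + 4 := by
    rw [Int.floor_lt]; push_cast; linarith [Int.lt_floor_add_one x]
  have h3 : ⌊4 * x⌋ < 4 * ⌊x⌋ + c ↔ Int.fract x < c / 4 := by
    rw [Int.floor_lt, Int.fract]; push_cast
    constructor <;> intro h <;> linarith
  rw [← h3]; omega

lemma fract_lt_quarter_iff (x : ℝ) : Int.fract x < 1 / 4 ↔ ⌊4 * x⌋ % 4 < 1 := by
  simpa using fract_lt_iff x 1

lemma fract_lt_half_iff (x : ℝ) : Int.fract x < 1 / 2 ↔ ⌊4 * x⌋ % 4 < 2 := by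
  rw [← fract_lt_iff]; norm_num

/-- A `1`-periodic, `L`-Lipschitz function bounded by `1` and vanishing at the integers. -/
structure IsBump (L : ℝ) (g : ℝ → ℝ) : Prop where
  abs_le_one : ∀ x, |g x| ≤ 1
  lip : ∀ x y, |g x - g y| ≤ L * |x - y|
  zero : ∀ n : ℤ, g n = 0
  periodic : Function.Periodic g 1

lemma IsBump.continuous {L : ℝ} {g : ℝ → ℝ} (hg : IsBump L g) : Continuous g :=
  (LipschitzWith.of_dist_le' (K := L) fun x y => by
    simpa [Real.dist_eq] using hg.lip x y).continuous

lemma IsBump.abs_sub_le_of_locally_const {L : ℝ} {g s : ℝ → ℝ} (hg : IsBump L g)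
    (hs : ∀ x, |s x| ≤ 1) (hs' : ∀ x y, ⌊4 * x⌋ = ⌊4 * y⌋ → s x = s y) (x y : ℝ) :
    |s x * g (4 * x) - s y * g (4 * y)| ≤ 4 * L * |x - y| := by
  wlog hxy : x ≤ y generalizing x y
  · rw [abs_sub_comm, abs_sub_comm x y]; exact this y x (le_of_not_ge hxy)
  by_cases hfl : ⌊4 * x⌋ = ⌊4 * y⌋
  · rw [hs' x y hfl, ← mul_sub, abs_mul]
    have h := hg.lip (4 * x) (4 * y)
    rw [← mul_sub, abs_mul, abs_of_pos (four_pos : (0 : ℝ) < 4)] at h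
    nlinarith [hs y, abs_nonneg (g (4 * x) - g (4 * y))]
  · have hlt : ⌊4 * x⌋ < ⌊4 * y⌋ :=
      lt_of_le_of_ne (Int.floor_mono (by linarith)) hfl
    have h1 : 4 * x < ⌊4 * y⌋ := Int.floor_lt.1 hlt
    have h2 := Int.floor_le (4 * y)
    have hx := hg.lip (4 * x) ⌊4 * y⌋
    have hy := hg.lip (4 * y) ⌊4 * y⌋
    rw [hg.zero, sub_zero] at hx hy
    rw [abs_of_neg (by linarith : 4 * x - (⌊4 * y⌋ : ℝ) < 0)] at hx
    rw [abs_of_nonneg (by linarith : 0 ≤ 4 * y - (⌊4 * y⌋ : ℝ))] at hy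
    rw [abs_of_nonpos (by linarith : x - y ≤ 0)]
    calc |s x * g (4 * x) - s y * g (4 * y)|
        ≤ |s x * g (4 * x)| + |s y * g (4 * y)| := abs_sub _ _
      _ ≤ |g (4 * x)| + |g (4 * y)| := by
          rw [abs_mul, abs_mul]
          gcongr <;> exact mul_le_of_le_one_left (abs_nonneg _) (hs _)
      _ ≤ _ := by linarith

lemma IsBump.comp_four_mul_add_one {L : ℝ} {g : ℝ → ℝ} (hg : IsBump L g) (x : ℝ) :
    g (4 * (x + 1)) = g (4 * x) := by
  have := hg.periodic.nat_mul 4 (4 * x)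
  simpa [mul_add] using this

lemma IsBump.comp_four_mul_intCast {L : ℝ} {g : ℝ → ℝ} (hg : IsBump L g) (n : ℤ) :
    g (4 * n) = 0 := by
  have := hg.zero (4 * n)
  simpa using this

/-- A continuous version of the Walsh function `w_{q_N}`. -/
noncomputable def signBump : ℕ → ℝ → ℝ
  | 0, x => (1 - Real.cos (2 * Real.pi * x)) / 2
  | N + 1, x => r0 x * signBump N (4 * x)

/-- A continuous function whose correlation with `D_{q_N}` grows linearly in `N`. -/
noncomputable def testBump : ℕ → ℝ → ℝ
  | 0, _ => 0
  | N + 1, x => if Int.fract x < 1 / 4 then testBump N (4 * x)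
      else if Int.fract x < 1 / 2 then signBump N (4 * x) else 0

lemma isBump_signBump (N : ℕ) : IsBump (4 * 8 ^ N) (signBump N) := by
  induction N with
  | zero =>
    refine ⟨fun x => ?_, fun x y => ?_, fun n => ?_, fun x => ?_⟩
    · have h1 := Real.cos_le_one (2 * Real.pi * x)
      have h2 := Real.neg_one_le_cos (2 * Real.pi * x)
      rw [signBump, abs_le]; constructor <;> linarith
    · have h := Real.abs_cos_sub_cos_le (2 * Real.pi * y) (2 * Real.pi * x)
      rw [← mul_sub, abs_mul, abs_of_pos Real.two_pi_pos, abs_sub_comm y x] at h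
      rw [signBump, signBump, ← sub_div, show ∀ a b : ℝ, 1 - a - (1 - b) = b - a by intros; ring,
        abs_div, abs_two]
      have := Real.pi_le_four
      nlinarith [abs_nonneg (x - y)]
    · rw [signBump, mul_comm, Real.cos_int_mul_two_pi]; simp
    · rw [signBump, signBump, mul_add, mul_one, Real.cos_add_two_pi]
  | succ N ih =>
    refine ⟨fun x => ?_, fun x y => ?_, fun n => ?_, fun x => ?_⟩
    · rw [signBump, abs_mul, abs_r0, one_mul]; exact ih.abs_le_one _
    · refine (ih.abs_sub_le_of_locally_const (fun x => (abs_r0 x).le) (fun x y h => ?_) x y).trans ?_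
      · simp only [r0, fract_lt_half_iff, h]
      · have : (0 : ℝ) < 8 ^ N := by positivity
        gcongr ?_ * _
        rw [pow_succ]; linarith
    · rw [signBump, ih.comp_four_mul_intCast, mul_zero]
    · rw [signBump, signBump, ih.comp_four_mul_add_one, r0_periodic]

lemma isBump_testBump (N : ℕ) : IsBump (4 * 8 ^ N) (testBump N) := by
  induction N with
  | zero => exact ⟨by simp [testBump], by simp [testBump], by simp [testBump], fun x => rfl⟩
  | succ N ih =>
    have hs := isBump_signBump N
    refine ⟨fun x => ?_, fun x y => ?_, fun n => ?_, fun x => ?_⟩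
    · rw [testBump]
      split_ifs
      · exact ih.abs_le_one _
      · exact hs.abs_le_one _
      · simp
    · have key : ∀ x, testBump (N + 1) x =
          (if ⌊4 * x⌋ % 4 < 1 then 1 else 0) * testBump N (4 * x) +
          (if ⌊4 * x⌋ % 4 < 1 then 0 else if ⌊4 * x⌋ % 4 < 2 then 1 else 0) *
            signBump N (4 * x) := fun x => by
        simp only [testBump, fract_lt_quarter_iff, fract_lt_half_iff]
        split_ifs <;> simp
      have h1 := ih.abs_sub_le_of_locally_const
        (s := fun x => if ⌊4 * x⌋ % 4 < 1 then 1 else 0)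
        (fun x => by split_ifs <;> simp) (fun x y h => by simp only [h]) x y
      have h2 := hs.abs_sub_le_of_locally_const
        (s := fun x => if ⌊4 * x⌋ % 4 < 1 then 0 else if ⌊4 * x⌋ % 4 < 2 then 1 else 0)
        (fun x => by split_ifs <;> simp) (fun x y h => by simp only [h]) x y
      rw [key, key, add_sub_add_comm]
      refine (abs_add_le _ _).trans ((add_le_add h1 h2).trans (le_of_eq ?_))
      ring
    · simp [testBump, ih.comp_four_mul_intCast]
    · simp [testBump, ih.comp_four_mul_add_one, hs.comp_four_mul_add_one]

lemma IsBump.intervalIntegrable_mul {L : ℝ} {g : ℝ → ℝ} (hg : IsBump L g) {F : ℝ → ℝ}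
    (hF : Measurable F) {C : ℝ} (hC : ∀ x, |F x| ≤ C) (a b : ℝ) :
    IntervalIntegrable (fun x => g x * F x) volume a b :=
  intervalIntegrable_of_abs_le (hg.continuous.measurable.mul hF) (fun x => by
    rw [Pi.mul_apply, abs_mul]
    exact (mul_le_of_le_one_left (abs_nonneg _) (hg.abs_le_one x)).trans (hC x)) a b

lemma fract_of_mem_quarter {j : ℕ} (hj : j < 4) {x : ℝ}
    (hx : x ∈ Ioo ((j : ℝ) / 4) (((j + 1 : ℕ) : ℝ) / 4)) : Int.fract x = x := by
  have h4 : ((j + 1 : ℕ) : ℝ) ≤ 4 := by exact_mod_cast hj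
  have h0 : (0 : ℝ) ≤ j := j.cast_nonneg
  refine Int.fract_eq_self.2 ⟨by linarith [hx.1], by linarith [hx.2]⟩

lemma r0_of_mem_quarter {j : ℕ} (hj : j < 4) {x : ℝ}
    (hx : x ∈ Ioo ((j : ℝ) / 4) (((j + 1 : ℕ) : ℝ) / 4)) : r0 x = if j < 2 then 1 else -1 := by
  rw [r0, fract_of_mem_quarter hj hx]
  obtain ⟨h1, h2⟩ := hx
  interval_cases j <;> norm_num at h1 h2 ⊢ <;> linarith

lemma one_add_r0_mul_of_mem_quarter {j : ℕ} (hj : j < 4) {x : ℝ}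
    (hx : x ∈ Ioo ((j : ℝ) / 4) (((j + 1 : ℕ) : ℝ) / 4)) :
    (1 + r0 x) * (1 + r0 (2 * x)) = if j = 0 then 4 else 0 := by
  rw [r0_of_mem_quarter hj hx]
  obtain ⟨h1, h2⟩ := hx
  interval_cases j <;> norm_num at h1 h2 ⊢
  · have : Int.fract (2 * x) = 2 * x := Int.fract_eq_self.2 ⟨by linarith, by linarith⟩
    rw [r0, this, if_pos (by linarith)]; norm_num
  · have : Int.fract (2 * x) = 2 * x := Int.fract_eq_self.2 ⟨by linarith, by linarith⟩
    rw [r0, this, if_neg (by linarith)]; norm_num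

lemma testBump_of_mem_quarter (N : ℕ) {j : ℕ} (hj : j < 4) {x : ℝ}
    (hx : x ∈ Ioo ((j : ℝ) / 4) (((j + 1 : ℕ) : ℝ) / 4)) :
    testBump (N + 1) x =
      if j = 0 then testBump N (4 * x) else if j = 1 then signBump N (4 * x) else 0 := by
  rw [testBump, fract_of_mem_quarter hj hx]
  obtain ⟨h1, h2⟩ := hx
  interval_cases j <;> norm_num at h1 h2 ⊢
  · intro; linarith
  · rw [if_neg (by linarith), if_pos (by linarith)]
  · rw [if_neg (by linarith), if_neg (by linarith)]
  · rw [if_neg (by linarith), if_neg (by linarith)]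

lemma integral_signBump_mul_walsh (N : ℕ) :
    ∫ x in (0 : ℝ)..1, signBump N x * walsh (qIdx N) x = 1 / 2 := by
  induction N with
  | zero =>
    have h : ∀ x, signBump 0 x * walsh (qIdx 0) x
        = (1 - Real.cos (2 * Real.pi * x)) / 2 := fun x => by
      simp [signBump, walsh, qIdx]
    simp_rw [h]
    rw [intervalIntegral.integral_div, intervalIntegral.integral_sub (by simp)
      (Continuous.intervalIntegrable (by fun_prop) _ _),
      intervalIntegral.integral_comp_mul_left _ Real.two_pi_pos.ne']
    simp
  | succ N ih =>
    rw [integral_eq_sum_quarters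
      ((isBump_signBump _).intervalIntegrable_mul (measurable_walsh _) fun x => (abs_walsh _ x).le)
      (F := fun _ x => signBump N x * walsh (qIdx N) x)
      (fun _ => (isBump_signBump N).periodic.mul (walsh_periodic _)) fun j _ x _ => ?_]
    · norm_num [ih]
    · rw [signBump, walsh_qIdx_succ]
      linear_combination (signBump N (4 * x) * walsh (qIdx N) (4 * x)) * r0_mul_self x

lemma integral_testBump_mul_walsh_nonneg (N : ℕ) :
    0 ≤ ∫ x in (0 : ℝ)..1, testBump N x * walsh (qIdx N) x := by
  induction N with
  | zero => simp [testBump]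
  | succ N ih =>
    rw [integral_eq_sum_quarters
      ((isBump_testBump _).intervalIntegrable_mul (measurable_walsh _) fun x => (abs_walsh _ x).le)
      (F := fun j x => if j = 0 then testBump N x * walsh (qIdx N) x else
        if j = 1 then signBump N x * walsh (qIdx N) x else 0) (fun j => ?_) fun j hj x hx => ?_]
    · simp [Finset.sum_range_succ, integral_signBump_mul_walsh]
      positivity
    · have h1 := (isBump_testBump N).periodic.mul (walsh_periodic (qIdx N))
      have h2 := (isBump_signBump N).periodic.mul (walsh_periodic (qIdx N))
      split_ifs
      · exact h1
      · exact h2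
      · exact fun x => rfl
    · rw [testBump_of_mem_quarter N hj hx, walsh_qIdx_succ, r0_of_mem_quarter hj hx]
      interval_cases j <;> simp

lemma le_integral_testBump_mul_walshDirichlet (N : ℕ) :
    N / 8 ≤ ∫ x in (0 : ℝ)..1, testBump N x * walshDirichlet (qIdx N) x := by
  induction N with
  | zero => simp [testBump]
  | succ N ih =>
    have hT := isBump_testBump N
    have hS := isBump_signBump N
    have i1 := hT.intervalIntegrable_mul (measurable_walshDirichlet (qIdx N))
      (abs_walshDirichlet_le _) 0 1
    have i2 := hT.intervalIntegrable_mul (measurable_walsh (qIdx N))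
      (fun x => (abs_walsh _ x).le) 0 1
    rw [integral_eq_sum_quarters ((isBump_testBump _).intervalIntegrable_mul
      (measurable_walshDirichlet _) (abs_walshDirichlet_le _))
      (F := fun j x => if j = 0 then 4 * (testBump N x * walshDirichlet (qIdx N) x) +
        testBump N x * walsh (qIdx N) x else
        if j = 1 then signBump N x * walsh (qIdx N) x else 0) (fun j => ?_) fun j hj x hx => ?_]
    · have h0 := integral_testBump_mul_walsh_nonneg N
      simp only [Finset.sum_range_succ, Finset.sum_range_zero]
      norm_num [integral_signBump_mul_walsh]
      rw [intervalIntegral.integral_add (i1.const_mul 4) i2, intervalIntegral.integral_const_mul]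
      linarith
    · intro x
      simp only [hT.periodic x, hS.periodic x, walsh_periodic _ x, walshDirichlet_periodic _ x]
    · rw [testBump_of_mem_quarter N hj hx, walshDirichlet_qIdx_succ,
        one_add_r0_mul_of_mem_quarter hj hx]
      interval_cases j <;> simp
      ring

/-! ### Variation of bumps -/

/-- The weights `n α_n / log (n + 1)`. -/
noncomputable abbrev logWeight (α : ℕ → ℝ) (n : ℕ) : ℝ := (n : ℝ) * α n / Real.log ((n : ℝ) + 1)

lemma logWeight_succ_pos {α : ℕ → ℝ} (hpos : ∀ n, 0 < α n) (n : ℕ) :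
    0 < logWeight α (n + 1) := by
  have h1 : 0 < Real.log (((n + 1 : ℕ) : ℝ) + 1) := 
    Real.log_pos (by push_cast; linarith [n.cast_nonneg (α := ℝ)])
  have := hpos (n + 1)
  have h2 : (0 : ℝ) < ((n + 1 : ℕ) : ℝ) := by positivity
  unfold logWeight
  positivity

lemma IntervalPack.sum_length_le {n : ℕ} (P : IntervalPack n) : ∑ i, (P.b i - P.a i) ≤ 1 := by
  have h := measure_biUnion_finset (μ := volume) (s := (Finset.univ : Finset (Fin n)))
    (f := fun i => Ioo (P.a i) (P.b i)) (fun i _ j _ hij => P.disj i j hij)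
    fun i _ => measurableSet_Ioo
  have hle : volume (⋃ i ∈ (Finset.univ : Finset (Fin n)), Ioo (P.a i) (P.b i))
      ≤ volume (Icc (0 : ℝ) 1) := by
    refine measure_mono (iUnion₂_subset fun i _ x hx => ⟨?_, ?_⟩)
    · exact (P.ha i).trans hx.1.le
    · exact hx.2.le.trans (P.hb i)
  rw [h] at hle
  simp only [Real.volume_Ioo, Real.volume_Icc, sub_zero] at hle
  rw [← ENNReal.ofReal_sum_of_nonneg fun i _ => sub_nonneg.2 (P.hab i).le] at hle
  exact (ENNReal.ofReal_le_ofReal_iff zero_le_one).1 hle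

lemma log_add_one_le_two_mul_sqrt {x : ℝ} (hx : 0 < x) :
    Real.log (x + 1) ≤ 2 * Real.sqrt x := by
  have h : x + 1 ≤ (Real.sqrt x + 1) ^ 2 := by
    nlinarith [Real.sq_sqrt hx.le, Real.sqrt_nonneg x]
  have hs := Real.sqrt_nonneg x
  calc Real.log (x + 1) ≤ Real.log ((Real.sqrt x + 1) ^ 2) :=
        Real.log_le_log (by linarith) h
    _ = 2 * Real.log (Real.sqrt x + 1) := by rw [Real.log_pow]; norm_num
    _ ≤ _ := by
        have := Real.log_le_sub_one_of_pos (show 0 < Real.sqrt x + 1 by linarith)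
        linarith

lemma inv_logWeight_succ_le_of_le {α : ℕ → ℝ} (hpos : ∀ n, 0 < α n) {a₀ : ℝ} (ha₀ : 0 < a₀)
    (hα : ∀ n, a₀ ≤ α n) {N i : ℕ} (hi : 64 ^ N ≤ i) :
    (logWeight α (i + 1))⁻¹ ≤ 2 / (a₀ * 8 ^ N) := by
  set x : ℝ := ((i + 1 : ℕ) : ℝ) with hx
  have hx0 : 0 < x := by positivity
  have h8 : (8 : ℝ) ^ N ≤ Real.sqrt x := by
    refine Real.le_sqrt_of_sq_le ?_
    rw [← pow_mul, mul_comm, pow_mul]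
    have : ((64 ^ N : ℕ) : ℝ) ≤ x := Nat.cast_le.2 (hi.trans (Nat.le_succ i))
    push_cast at this
    norm_num; exact this
  have hlog := log_add_one_le_two_mul_sqrt hx0
  have hs0 : 0 < Real.sqrt x := Real.sqrt_pos.2 hx0
  rw [logWeight, inv_div, div_le_div_iff₀ (mul_pos hx0 (hpos _)) (by positivity)]
  calc Real.log (x + 1) * (a₀ * 8 ^ N) ≤ (2 * Real.sqrt x) * (a₀ * Real.sqrt x) := by gcongr
    _ = 2 * (x * a₀) := by linear_combination (2 * a₀) * Real.mul_self_sqrt hx0.le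
    _ ≤ 2 * (x * α (i + 1)) := by gcongr; exact hα _

/-- A bound for the `Λ`-variation of a bump with Lipschitz constant `4 * 8 ^ N`. -/
noncomputable def bumpVariation (α : ℕ → ℝ) (a₀ : ℝ) (N : ℕ) : ℝ :=
  2 * ∑ i ∈ Finset.range (64 ^ N), (logWeight α (i + 1))⁻¹ + 8 / a₀

lemma IsBump.sum_variation_le {α : ℕ → ℝ} (hpos : ∀ n, 0 < α n) {a₀ : ℝ} (ha₀ : 0 < a₀)
    (hα : ∀ n, a₀ ≤ α n) {N : ℕ} {g : ℝ → ℝ} (hg : IsBump (4 * 8 ^ N) g) {n : ℕ}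
    (P : IntervalPack n) :
    ∑ i : Fin n, |g (P.b i) - g (P.a i)| / logWeight α (i + 1) ≤ bumpVariation α a₀ N := by
  have hw := logWeight_succ_pos hpos
  have key : ∀ i : Fin n, |g (P.b i) - g (P.a i)| / logWeight α (i + 1) ≤
      (if (i : ℕ) < 64 ^ N then 2 * (logWeight α (i + 1))⁻¹ else 0)
        + 8 / a₀ * (P.b i - P.a i) := fun i => by
    have hl : 0 ≤ P.b i - P.a i := sub_nonneg.2 (P.hab i).le
    have hwi := inv_pos.2 (hw i)
    rw [div_eq_mul_inv]
    split_ifs with hi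
    · have h2 : |g (P.b i) - g (P.a i)| ≤ 2 :=
        (abs_sub (g (P.b i)) (g (P.a i))).trans
          (by linarith [hg.abs_le_one (P.b i), hg.abs_le_one (P.a i)])
      have : 0 ≤ 8 / a₀ * (P.b i - P.a i) := by positivity
      have := mul_le_mul_of_nonneg_right h2 hwi.le
      linarith
    · have h1 := hg.lip (P.b i) (P.a i)
      rw [abs_of_nonneg hl] at h1
      have h2 := inv_logWeight_succ_le_of_le hpos ha₀ hα (not_lt.1 hi)
      calc _ ≤ (4 * 8 ^ N * (P.b i - P.a i)) * (2 / (a₀ * 8 ^ N)) := by gcongr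
        _ = _ := by field_simp; ring
  refine (Finset.sum_le_sum fun i _ => key i).trans ?_
  rw [Finset.sum_add_distrib, bumpVariation, Finset.mul_sum]
  refine add_le_add ?_ ?_
  · rw [Fin.sum_univ_eq_sum_range
      (fun i => if i < 64 ^ N then 2 * (logWeight α (i + 1))⁻¹ else (0 : ℝ)) n,
      ← Finset.sum_filter]
    refine Finset.sum_le_sum_of_subset_of_nonneg (fun i hi => ?_) fun i _ _ => ?_
    · simpa using (Finset.mem_filter.1 hi).2
    · have := inv_pos.2 (hw i); positivity
  · rw [← Finset.mul_sum]
    exact mul_le_of_le_one_right (by positivity) P.sum_length_le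

lemma isLittleO_sum_inv_mul {α : ℕ → ℝ} (htop : Tendsto α atTop atTop) :
    (fun n => ∑ i ∈ Finset.range n, (α (i + 1))⁻¹ * (1 / ((i : ℝ) + 1))) =o[atTop]
      fun n => ∑ i ∈ Finset.range n, 1 / ((i : ℝ) + 1) := by
  refine Asymptotics.IsLittleO.sum_range ?_ (fun i => by positivity)
    Real.tendsto_sum_range_one_div_nat_succ_atTop
  have h : Tendsto (fun i => (α (i + 1))⁻¹) atTop (nhds 0) :=
    (htop.comp (tendsto_add_atTop_nat 1)).inv_tendsto_atTop
  have := ((Asymptotics.isLittleO_one_iff ℝ).2 h).mul_isBigO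
    (Asymptotics.isBigO_refl (fun i : ℕ => 1 / ((i : ℝ) + 1)) atTop)
  simpa using this

lemma log_sixtyFour_le : Real.log 64 ≤ 5 := by
  have h : (64 : ℝ) = 2 ^ 6 := by norm_num
  rw [h, Real.log_pow]
  have := Real.log_two_lt_d9
  push_cast; linarith

lemma sum_one_div_le (N : ℕ) (hN : 1 ≤ N) :
    ∑ i ∈ Finset.range (64 ^ N), 1 / ((i : ℝ) + 1) ≤ 6 * N := by
  have h := harmonic_le_one_add_log (64 ^ N)
  have h1 : (1 : ℝ) ≤ N := by exact_mod_cast hN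
  simp only [harmonic, Rat.cast_sum, Rat.cast_inv, Nat.cast_pow] at h
  push_cast at h
  simp only [one_div]
  rw [Real.log_pow] at h
  nlinarith [log_sixtyFour_le]

lemma inv_logWeight_succ_le {α : ℕ → ℝ} (hpos : ∀ n, 0 < α n) {N i : ℕ} (hN : 1 ≤ N)
    (hi : i < 64 ^ N) :
    (logWeight α (i + 1))⁻¹ ≤ 6 * N * ((α (i + 1))⁻¹ * (1 / ((i : ℝ) + 1))) := by
  have hα := hpos (i + 1)
  have h1 : (1 : ℝ) ≤ N := by exact_mod_cast hN
  have hlog : Real.log (((i + 1 : ℕ) : ℝ) + 1) ≤ 6 * N := by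
    have h2 : (((i + 1 : ℕ) : ℝ) + 1) ≤ 2 * 64 ^ N := by
      have : i + 1 + 1 ≤ 2 * 64 ^ N := by omega
      exact_mod_cast this
    have h3 := Real.log_le_log (by positivity) h2
    rw [Real.log_mul (by norm_num) (by positivity), Real.log_pow] at h3
    have := Real.log_two_lt_d9
    nlinarith [log_sixtyFour_le]
  rw [logWeight, inv_div]
  calc _ ≤ 6 * N / (((i + 1 : ℕ) : ℝ) * α (i + 1)) := by gcongr
    _ = _ := by push_cast; field_simp

lemma exists_bumpVariation_le {α : ℕ → ℝ} (hpos : ∀ n, 0 < α n)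
    (htop : Tendsto α atTop atTop) (a₀ : ℝ) {ε : ℝ} (hε : 0 < ε) :
    ∃ N : ℕ, 1 ≤ N ∧ 1 + bumpVariation α a₀ N ≤ ε * N ^ 2 := by
  have hpow : Tendsto (fun N : ℕ => 64 ^ N) atTop atTop :=
    tendsto_pow_atTop_atTop_of_one_lt (by norm_num)
  have h1 := (((isLittleO_sum_inv_mul htop).comp_tendsto hpow).def
    (show (0 : ℝ) < ε / 144 by positivity))
  have h2 : ∀ᶠ N : ℕ in atTop, 1 + 8 / a₀ ≤ ε / 2 * (N : ℝ) ^ 2 :=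
    (((tendsto_pow_atTop two_ne_zero).comp tendsto_natCast_atTop_atTop).const_mul_atTop
      (half_pos hε)).eventually_ge_atTop _
  obtain ⟨N, h1, h2, hN⟩ := (h1.and (h2.and (eventually_ge_atTop 1))).exists
  refine ⟨N, hN, ?_⟩
  simp only [Function.comp_apply] at h1
  have hsum : ∑ i ∈ Finset.range (64 ^ N), (α (i + 1))⁻¹ * (1 / ((i : ℝ) + 1)) ≤
      ε / 144 * (6 * N) := by
    refine (Real.le_norm_self _).trans (h1.trans ?_)
    rw [Real.norm_of_nonneg (Finset.sum_nonneg fun i _ => by positivity)]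
    gcongr
    exact sum_one_div_le N hN
  have hS : ∑ i ∈ Finset.range (64 ^ N), (logWeight α (i + 1))⁻¹ ≤
      6 * N * (ε / 144 * (6 * N)) := by
    refine (Finset.sum_le_sum fun i hi =>
      inv_logWeight_succ_le hpos hN (Finset.mem_range.1 hi)).trans ?_
    rw [← Finset.mul_sum]
    gcongr
  rw [bumpVariation]
  linarith

lemma exists_pos_le_of_tendsto_atTop {α : ℕ → ℝ} (hpos : ∀ n, 0 < α n)
    (htop : Tendsto α atTop atTop) : ∃ a₀ > 0, ∀ n, a₀ ≤ α n := by
  obtain ⟨n₀, h⟩ := (Nat.cofinite_eq_atTop ▸ htop).exists_forall_le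
  exact ⟨α n₀, hpos n₀, h⟩

/-! ### Series of tensor squares of bumps -/

lemma hasSum_integral_zero_one {F : ℕ → ℝ → ℝ} (hF : ∀ k, Measurable (F k)) {c : ℕ → ℝ}
    (hc : Summable c) (h : ∀ k x, |F k x| ≤ c k) :
    HasSum (fun k => ∫ x in (0 : ℝ)..1, F k x) (∫ x in (0 : ℝ)..1, ∑' k, F k x) :=
  intervalIntegral.hasSum_integral_of_dominated_convergence (fun k _ => c k)
    (fun k => (hF k).aestronglyMeasurable) (fun k => Eventually.of_forall fun x _ => h k x)
    (Eventually.of_forall fun _ _ => hc) (by simp)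
    (Eventually.of_forall fun x _ =>
      (hc.of_norm_bounded fun k => h k x).hasSum)

lemma IsBump.abs_integral_mul_walsh_le {L : ℝ} {g : ℝ → ℝ} (hg : IsBump L g) (m : ℕ) :
    |∫ x in (0 : ℝ)..1, g x * walsh m x| ≤ 1 := by
  have := intervalIntegral.norm_integral_le_of_norm_le_const (a := 0) (b := 1) (C := 1)
    (f := fun x => g x * walsh m x) fun x _ => by
      rw [Real.norm_eq_abs, abs_mul, abs_walsh, mul_one]; exact hg.abs_le_one x
  simpa using this

lemma IsBump.sum_integral_mul_walsh {L : ℝ} {g : ℝ → ℝ} (hg : IsBump L g) (q : ℕ) :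
    ∑ m ∈ Finset.range q, ∫ x in (0 : ℝ)..1, g x * walsh m x =
      ∫ x in (0 : ℝ)..1, g x * walshDirichlet q x := by
  rw [← intervalIntegral.integral_finsetSum fun m _ =>
    hg.intervalIntegrable_mul (measurable_walsh m) (fun x => (abs_walsh m x).le) 0 1]
  simp only [walshDirichlet, Finset.mul_sum]

/-- The function `∑ c_k g_k(x) g_k(y)`. -/
noncomputable def bumpSeries (c : ℕ → ℝ) (g : ℕ → ℝ → ℝ) (x y : ℝ) : ℝ :=
  ∑' k, c k * g k x * g k y

section BumpSeries

variable {c : ℕ → ℝ} {L : ℕ → ℝ} {g : ℕ → ℝ → ℝ}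

lemma abs_bumpSeries_term_le (hc0 : ∀ k, 0 ≤ c k) (hg : ∀ k, IsBump (L k) (g k)) (k : ℕ)
    (x y : ℝ) : |c k * g k x * g k y| ≤ c k := by
  rw [mul_assoc, abs_mul, abs_mul, abs_of_nonneg (hc0 k)]
  exact mul_le_of_le_one_right (hc0 k)
    (mul_le_one₀ ((hg k).abs_le_one x) (abs_nonneg _) ((hg k).abs_le_one y))

lemma summable_bumpSeries (hc : Summable c) (hc0 : ∀ k, 0 ≤ c k)
    (hg : ∀ k, IsBump (L k) (g k)) (x y : ℝ) : Summable fun k => c k * g k x * g k y :=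
  hc.of_norm_bounded fun k => abs_bumpSeries_term_le hc0 hg k x y

lemma bumpSeries_comm (x y : ℝ) : bumpSeries c g x y = bumpSeries c g y x := by
  unfold bumpSeries
  exact tsum_congr fun k => by ring

lemma continuous_bumpSeries (hc : Summable c) (hc0 : ∀ k, 0 ≤ c k)
    (hg : ∀ k, IsBump (L k) (g k)) : Continuous (Function.uncurry (bumpSeries c g)) := by
  refine continuous_tsum (f := fun k (p : ℝ × ℝ) => c k * g k p.1 * g k p.2) (fun k => ?_) hc
    fun k p => abs_bumpSeries_term_le hc0 hg k p.1 p.2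
  have := (hg k).continuous
  fun_prop

lemma hasSum_fourierCoef_bumpSeries (hc : Summable c) (hc0 : ∀ k, 0 ≤ c k)
    (hg : ∀ k, IsBump (L k) (g k)) (m n : ℕ) :
    HasSum (fun k => c k * (∫ x in (0 : ℝ)..1, g k x * walsh m x) *
      ∫ y in (0 : ℝ)..1, g k y * walsh n y) (fourierCoef (bumpSeries c g) m n) := by
  have hm : ∀ k, Measurable (g k) := fun k => (hg k).continuous.measurable
  have inner : ∀ x, ∫ y in (0 : ℝ)..1, bumpSeries c g x y * walsh m x * walsh n y =
      ∑' k, c k * g k x * walsh m x * ∫ y in (0 : ℝ)..1, g k y * walsh n y := fun x => by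
    have h := hasSum_integral_zero_one
      (F := fun k y => c k * g k x * walsh m x * (g k y * walsh n y))
      (fun k => ((hm k).mul (measurable_walsh n)).const_mul _) hc fun k y => by
        have := abs_bumpSeries_term_le hc0 hg k x y
        rw [show c k * g k x * walsh m x * (g k y * walsh n y) =
          c k * g k x * g k y * (walsh m x * walsh n y) by ring, abs_mul, abs_mul (walsh m x),
          abs_walsh, abs_walsh]
        simpa using this
    simp only [intervalIntegral.integral_const_mul] at h
    rw [h.tsum_eq]
    refine intervalIntegral.integral_congr fun y _ => ?_
    simp only [bumpSeries]
    rw [← tsum_mul_right, ← tsum_mul_right]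
    exact tsum_congr fun k => by ring
  have h := hasSum_integral_zero_one
    (F := fun k x => c k * g k x * walsh m x * ∫ y in (0 : ℝ)..1, g k y * walsh n y)
    (fun k => (((hm k).const_mul _).mul (measurable_walsh m)).mul_const _) hc fun k x => by
      rw [abs_mul, abs_mul, abs_walsh, mul_one, abs_mul, abs_of_nonneg (hc0 k), mul_assoc]
      exact mul_le_of_le_one_right (hc0 k) (mul_le_one₀ ((hg k).abs_le_one x) (abs_nonneg _)
        ((hg k).abs_integral_mul_walsh_le n))
  simp only [mul_assoc (c _) (g _ _), intervalIntegral.integral_mul_const,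
    intervalIntegral.integral_const_mul] at h
  simp only [fourierCoef, inner, mul_assoc (c _) (g _ _)]
  exact h

lemma hasSum_partialSum_bumpSeries (hc : Summable c) (hc0 : ∀ k, 0 ≤ c k)
    (hg : ∀ k, IsBump (L k) (g k)) (q : ℕ) :
    HasSum (fun k => c k * (∫ x in (0 : ℝ)..1, g k x * walshDirichlet q x) ^ 2)
      (partialSum (bumpSeries c g) q q 0 0) := by
  have h := hasSum_sum (s := Finset.range q) fun m _ =>
    hasSum_sum (s := Finset.range q) fun n _ => hasSum_fourierCoef_bumpSeries hc hc0 hg m n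
  simp only [partialSum, walsh_zero_right, mul_one]
  convert h using 2 with k
  rw [← (hg k).sum_integral_mul_walsh, sq, Finset.sum_mul_sum, Finset.mul_sum]
  refine Finset.sum_congr rfl fun m _ => ?_
  rw [Finset.mul_sum]
  exact Finset.sum_congr rfl fun n _ => by ring

lemma sharpV1_bumpSeries_le (hc : Summable c) (hc0 : ∀ k, 0 ≤ c k)
    (hg : ∀ k, IsBump (L k) (g k)) {Λ : ℕ → ℝ} (hΛ : ∀ n, 0 < Λ (n + 1)) {V : ℕ → ℝ}
    (hV : ∀ k (n : ℕ) (P : IntervalPack n),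
      ∑ i : Fin n, |g k (P.b i) - g k (P.a i)| / Λ (i + 1) ≤ V k)
    (hcV : Summable fun k => c k * V k) :
    sharpV1 Λ 0 (bumpSeries c g) ≤ ENNReal.ofReal (∑' k, c k * V k) := by
  refine iSup₂_le fun n P => ?_
  rw [sharpSum, ← ENNReal.ofReal_sum_of_nonneg fun i _ => by
    have := hΛ i; simp only [zero_add]; positivity]
  refine ENNReal.ofReal_le_ofReal ?_
  simp only [zero_add]
  have hincr : ∀ (i : Fin n) (k : ℕ), |c k * (|g k (P.b i) - g k (P.a i)| / Λ (i + 1))|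
      ≤ c k * (2 / Λ (i + 1)) := fun i k => by
    have := hΛ i
    rw [abs_of_nonneg (mul_nonneg (hc0 k) (by positivity))]
    have := hc0 k
    gcongr
    exact (abs_sub _ _).trans
      (by linarith [(hg k).abs_le_one (P.b i), (hg k).abs_le_one (P.a i)])
  have hs : ∀ i : Fin n, Summable fun k => c k * (|g k (P.b i) - g k (P.a i)| / Λ (i + 1)) :=
    fun i => (hc.mul_right _).of_norm_bounded (hincr i)
  calc ∑ i : Fin n, |bumpSeries c g (P.b i) (P.y i) - bumpSeries c g (P.a i) (P.y i)| / Λ (i + 1)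
      ≤ ∑ i : Fin n, ∑' k, c k * (|g k (P.b i) - g k (P.a i)| / Λ (i + 1)) := by
        refine Finset.sum_le_sum fun i _ => ?_
        have hi := hΛ i
        rw [div_le_iff₀ hi, ← tsum_mul_right, ← Real.norm_eq_abs, bumpSeries, bumpSeries,
          ← (summable_bumpSeries hc hc0 hg _ _).tsum_sub (summable_bumpSeries hc hc0 hg _ _)]
        refine tsum_of_norm_bounded ((hs i).mul_right _).hasSum fun k => ?_
        rw [mul_assoc (c k) (_ / _), div_mul_cancel₀ _ hi.ne', ← sub_mul, ← mul_sub,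
          Real.norm_eq_abs, abs_mul, abs_mul, abs_of_nonneg (hc0 k)]
        exact mul_le_of_le_one_right (mul_nonneg (hc0 k) (abs_nonneg _)) ((hg k).abs_le_one _)
    _ = ∑' k, c k * ∑ i : Fin n, |g k (P.b i) - g k (P.a i)| / Λ (i + 1) := by
        rw [← Summable.tsum_finsetSum fun i _ => hs i]
        simp only [Finset.mul_sum]
    _ ≤ ∑' k, c k * V k := by
        refine Summable.tsum_le_tsum (fun k => ?_) ?_ hcV
        · exact mul_le_mul_of_nonneg_left (hV k n P.toIntervalPack) (hc0 k)
        · simp only [Finset.mul_sum]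
          exact summable_sum fun i _ => hs i

end BumpSeries

/-- for any `α_n → ∞` there is a continuous
`f ∈ {n α_n / log(n+1)}^# BV` whose quadratic partial sums at `(0,0)` are unbounded. -/
theorem stmt17 (α : ℕ → ℝ) (hpos : ∀ n, 0 < α n) (htop : Tendsto α atTop atTop) :
    ∃ f : ℝ → ℝ → ℝ,
      ContinuousOn (Function.uncurry f) (Icc (0 : ℝ) 1 ×ˢ Icc (0 : ℝ) 1) ∧
      SharpBV (fun n => (n : ℝ) * α n / Real.log ((n : ℝ) + 1)) f ∧
      ¬ BddAbove (Set.range fun N : ℕ => |partialSum f N N 0 0|) := by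
  obtain ⟨a₀, ha₀, hα⟩ := exists_pos_le_of_tendsto_atTop hpos htop
  choose N hN hVN using fun k : ℕ => exists_bumpVariation_le hpos htop a₀
    (show (0 : ℝ) < (1 / 4) ^ k by positivity)
  have hN0 : ∀ k, (0 : ℝ) < N k := fun k => by exact_mod_cast hN k
  set c : ℕ → ℝ := fun k => 2 ^ k / (N k : ℝ) ^ 2 with hc_def
  set V : ℕ → ℝ := fun k => bumpVariation α a₀ (N k) with hV_def
  have hc0 : ∀ k, 0 ≤ c k := fun k => by positivity
  have hV0 : ∀ k, 0 ≤ V k := fun k => by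
    have : ∀ i, 0 ≤ (logWeight α (i + 1))⁻¹ := fun i => (inv_pos.2 (logWeight_succ_pos hpos i)).le
    have := Finset.sum_nonneg fun i (_ : i ∈ Finset.range (64 ^ N k)) => this i
    simp only [hV_def, bumpVariation]
    positivity
  have hbound : ∀ k, c k * (1 + V k) ≤ (1 / 2) ^ k := fun k => by
    calc c k * (1 + V k) ≤ c k * ((1 / 4) ^ k * (N k : ℝ) ^ 2) :=
          mul_le_mul_of_nonneg_left (hVN k) (hc0 k)
      _ = (2 * (1 / 4)) ^ k := by
          have := (hN0 k).ne'
          rw [mul_pow, hc_def]; field_simp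
      _ = _ := by norm_num
  have hc : Summable c := summable_geometric_two.of_nonneg_of_le hc0 fun k => by
    nlinarith [hbound k, mul_nonneg (hc0 k) (hV0 k)]
  have hcV : Summable fun k => c k * V k :=
    summable_geometric_two.of_nonneg_of_le (fun k => mul_nonneg (hc0 k) (hV0 k)) fun k => by
      nlinarith [hbound k, hc0 k]
  have hg : ∀ k, IsBump (4 * 8 ^ N k) (testBump (N k)) := fun k => isBump_testBump (N k)
  refine ⟨bumpSeries c fun k => testBump (N k), (continuous_bumpSeries hc hc0 hg).continuousOn,
    ?_, ?_⟩
  · have h1 := sharpV1_bumpSeries_le hc hc0 hg (logWeight_succ_pos hpos)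
      (fun k n P => (hg k).sum_variation_le hpos ha₀ hα P) hcV
    have h2 : (fun x y => bumpSeries c (fun k => testBump (N k)) y x) =
        bumpSeries c fun k => testBump (N k) := by
      ext x y; exact bumpSeries_comm y x
    rw [SharpBV, sharpV, sharpV2, h2]
    exact ENNReal.add_ne_top.2 ⟨ne_top_of_le_ne_top ofReal_ne_top h1,
      ne_top_of_le_ne_top ofReal_ne_top h1⟩
  · rintro ⟨B, hB⟩
    obtain ⟨k, hk⟩ := pow_unbounded_of_one_lt (64 * B) (one_lt_two (α := ℝ))
    have h1 := hB ⟨qIdx (N k), rfl⟩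
    have hsum := hasSum_partialSum_bumpSeries hc hc0 hg (qIdx (N k))
    have h2 := le_hasSum hsum k fun j _ => mul_nonneg (hc0 j) (sq_nonneg _)
    have h3 : ((N k : ℝ) / 8) ^ 2 ≤
        (∫ x in (0 : ℝ)..1, testBump (N k) x * walshDirichlet (qIdx (N k)) x) ^ 2 :=
      pow_le_pow_left₀ (by positivity) (le_integral_testBump_mul_walshDirichlet (N k)) 2
    have h4 : c k * ((N k : ℝ) / 8) ^ 2 = 2 ^ k / 64 := by
      have := (hN0 k).ne'
      rw [hc_def]; field_simp; norm_num
    have h5 := mul_le_mul_of_nonneg_left h3 (hc0 k)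
    have h6 := le_abs_self (partialSum (bumpSeries c fun k => testBump (N k))
      (qIdx (N k)) (qIdx (N k)) 0 0)
    simp only at h1
    linarith
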